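/- Let G be a connected graph with n vertices and minimum degree at least k, and let γ(G) denote its domination number. Then γ_c(G) < γ(G) + (n/(k+1))·(ln⌈ln(k+1)⌉ + 3). -/

import Mathlib

/-- `X` is a dominating set of `G`: every vertex outside `X` has a neighbor in `X`. -/
def IsDominatingSet {V : Type*} (G : SimpleGraph V) (X : Set V) : Prop :=
  ∀ v ∉ X, ∃ u ∈ X, G.Adj u v

/-- The domination number `γ(G)`: the minimum size of a dominating set. -/
noncomputable def dominationNumber {V : Type*} (G : SimpleGraph V) : ℕ :=
  sInf {c | ∃ X : Set V, IsDominatingSet G X ∧ X.ncard = c}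

/-- The connected domination number `γ_c(G)`: the minimum size of a dominating set inducing a
connected subgraph. -/
noncomputable def connectedDominationNumber {V : Type*} (G : SimpleGraph V) : ℕ :=
  sInf {c | ∃ X : Set V, IsDominatingSet G X ∧ (G.induce X).Connected ∧ X.ncard = c}

open Finset in
lemma aux_pick {V : Type*} [Fintype V] [DecidableEq V] (G : SimpleGraph V) [DecidableRel G.Adj] (k : ℕ)
    [Nonempty V] (hdeg : ∀ v, k ≤ G.degree v) (S : Finset V) :
    ∃ v, S.card * (k + 1) ≤ Fintype.card V * (S.filter (fun s => s = v ∨ G.Adj v s)).card := by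
  by_contra! h
  have h1 := Finset.sum_card_bipartiteAbove_eq_sum_card_bipartiteBelow
    (s := (Finset.univ : Finset V)) (t := S) (fun v s => s = v ∨ G.Adj v s)
  have h2 : ∀ s ∈ S, k + 1 ≤ (Finset.bipartiteBelow (fun v s => s = v ∨ G.Adj v s) Finset.univ s).card := by
    intro s _
    have : Finset.bipartiteBelow (fun v s => s = v ∨ G.Adj v s) Finset.univ s
        = insert s (G.neighborFinset s) := by
      ext x
      simp [Finset.bipartiteBelow, G.adj_comm x s, eq_comm]
    rw [this, Finset.card_insert_of_notMem (by simp)]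
    have := hdeg s
    simpa using this
  have h3 := Finset.sum_le_sum h2
  rw [Finset.sum_const, smul_eq_mul, ← h1] at h3
  have h4 : ∑ v : V, Fintype.card V * (S.filter (fun s => s = v ∨ G.Adj v s)).card
      < ∑ v : V, S.card * (k + 1) :=
    Finset.sum_lt_sum_of_nonempty Finset.univ_nonempty (fun v _ => h v)
  rw [← Finset.mul_sum, Finset.sum_const, smul_eq_mul, Finset.card_univ] at h4
  have h5 := lt_of_mul_lt_mul_left h4 (Nat.zero_le _)
  exact absurd h3 (not_le.mpr h5)

lemma aux_harm (i j : ℕ) (hij : i ≤ j) :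
    (harmonic i : ℝ) ≤ harmonic j ∧
      (j : ℝ) - i ≤ j * ((harmonic j : ℝ) - harmonic i) := by
  induction j, hij using Nat.le_induction with
  | base => simp
  | succ j hj ih =>
    obtain ⟨h1, h2⟩ := ih
    have hp : (0:ℝ) < (j:ℝ) + 1 := by positivity
    have e : (harmonic (j+1) : ℝ) = harmonic j + ((j:ℝ)+1)⁻¹ := by
      rw [harmonic_succ]; push_cast; rfl
    rw [e]
    refine ⟨by have := inv_pos.mpr hp; linarith, ?_⟩
    push_cast
    have : ((j:ℝ)+1) * ((j:ℝ)+1)⁻¹ = 1 := mul_inv_cancel₀ hp.ne'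
    nlinarith

lemma aux_harm_div (i j : ℕ) (hi : 1 ≤ i) (hij : i ≤ j) :
    1 - (i:ℝ) / j ≤ (harmonic j : ℝ) - harmonic i := by
  have hj : (0:ℝ) < j := by exact_mod_cast (by omega : 0 < j)
  have h := (aux_harm i j hij).2
  rw [← div_self hj.ne', ← sub_div, div_le_iff₀ hj]
  linarith

lemma aux_harm_one (j : ℕ) (hj : 1 ≤ j) : (1:ℝ) ≤ harmonic j := by
  have := (aux_harm 1 j hj).1
  simpa using this

/-- greedy domination -/
lemma aux_dom {V : Type*} [Fintype V] [DecidableEq V] (G : SimpleGraph V) [DecidableRel G.Adj] (k : ℕ)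
    [Nonempty V] (hdeg : ∀ v, k ≤ G.degree v) (a : ℝ) (ha : a = (Fintype.card V : ℝ) / (k + 1))
    (c : ℕ) : ∀ U : Finset V, U.card = c → ∃ D : Finset V,
      (∀ u ∈ U, ∃ d ∈ D, u = d ∨ G.Adj d u) ∧
      ∀ j : ℕ, 1 ≤ j → (D.card : ℝ) ≤ c / j + a * (harmonic j - 1) := by
  have hk : (0:ℝ) < (k:ℝ) + 1 := by positivity
  have ha0 : 0 < a := by
    rw [ha]; have : (0:ℝ) < Fintype.card V := by exact_mod_cast Fintype.card_pos
    positivity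
  induction c using Nat.strong_induction_on with
  | _ c ih =>
  intro U hU
  rcases Nat.eq_zero_or_pos c with h0 | hpos
  · subst h0
    refine ⟨∅, by simp [Finset.card_eq_zero.mp hU], fun j hj => ?_⟩
    have := aux_harm_one j hj
    have : 0 ≤ a * ((harmonic j : ℝ) - 1) := mul_nonneg ha0.le (by linarith)
    simpa using this
  obtain ⟨v, hv⟩ := aux_pick G k hdeg U
  set T := U.filter (fun s => s = v ∨ G.Adj v s) with hT
  have hcT : (c:ℝ) ≤ a * T.card := by
    rw [ha, div_mul_eq_mul_div, le_div_iff₀ hk]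
    rw [hU] at hv
    exact_mod_cast hv
  have hTpos : 1 ≤ T.card := by
    by_contra hlt
    have : T.card = 0 := by omega
    rw [this] at hcT
    have : (0:ℝ) < c := by exact_mod_cast hpos
    simp at hcT; linarith
  have hTU : T ⊆ U := Finset.filter_subset _ _
  have hcard : (U \ T).card = c - T.card := by rw [Finset.card_sdiff_of_subset hTU, hU]
  have hTc : T.card ≤ c := hU ▸ Finset.card_le_card hTU
  obtain ⟨D, hD1, hD2⟩ := ih (c - T.card) (by omega) (U \ T) hcard
  refine ⟨insert v D, ?_, ?_⟩
  · intro u hu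
    by_cases huT : u ∈ T
    · exact ⟨v, by simp, (Finset.mem_filter.mp huT).2⟩
    · obtain ⟨d, hd, h⟩ := hD1 u (by simp [hu, huT])
      exact ⟨d, by simp [hd], h⟩
  · intro j hj
    have hc1 : ((insert v D).card : ℝ) ≤ D.card + 1 := by
      exact_mod_cast Finset.card_insert_le v D
    have hjp : (0:ℝ) < j := by exact_mod_cast hj
    have htp : (0:ℝ) < T.card := by exact_mod_cast hTpos
    rcases le_total j T.card with hjt | hjt
    · have h := hD2 j hj
      rw [Nat.cast_sub hTc, sub_div] at h
      have : 1 ≤ (T.card : ℝ) / j := by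
        rw [le_div_iff₀ hjp]; simpa using (by exact_mod_cast hjt : (j:ℝ) ≤ T.card)
      linarith
    · have h := hD2 T.card hTpos
      rw [Nat.cast_sub hTc, sub_div, div_self htp.ne'] at h
      have hh := aux_harm_div _ _ hTpos hjt
      have h5 := mul_le_mul_of_nonneg_left hh ha0.le
      have h6 : (c:ℝ) * (1 / T.card - 1 / j) ≤ (a * T.card) * (1 / T.card - 1 / j) := by
        apply mul_le_mul_of_nonneg_right hcT
        rw [sub_nonneg]
        exact one_div_le_one_div_of_le htp (by exact_mod_cast hjt)
      have e1 : (a * T.card) * (1 / T.card - 1 / j) = a * (1 - (T.card:ℝ) / j) := by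
        field_simp
      have e2 : (c:ℝ) * (1 / T.card - 1 / j) = c / T.card - c / j := by ring
      rw [e1, e2] at h6
      linarith

/-- adjacency inside `X` -/
def auxStep {V : Type*} (G : SimpleGraph V) (X : Finset V) (x y : V) : Prop :=
  G.Adj x y ∧ x ∈ X ∧ y ∈ X

/-- reachability inside `X` -/
def auxR {V : Type*} (G : SimpleGraph V) (X : Finset V) : V → V → Prop :=
  Relation.ReflTransGen (auxStep G X)

lemma auxR_mono {V : Type*} {G : SimpleGraph V} {X Y : Finset V} (h : X ⊆ Y) {x y : V}
    (hr : auxR G X x y) : auxR G Y x y :=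
  Relation.ReflTransGen.mono
    (r := auxStep G X) (p := auxStep G Y) (fun _ _ hh => ⟨hh.1, h hh.2.1, h hh.2.2⟩) _ _ hr

lemma auxR_symm {V : Type*} {G : SimpleGraph V} {X : Finset V} {x y : V}
    (hr : auxR G X x y) : auxR G X y x := by
  induction hr with
  | refl => exact Relation.ReflTransGen.refl
  | tail _ hbc ih => exact Relation.ReflTransGen.head ⟨hbc.1.symm, hbc.2.2, hbc.2.1⟩ ih

lemma auxR_trans {V : Type*} {G : SimpleGraph V} {X : Finset V} {x y z : V}
    (h : auxR G X x y) (hn : auxR G X y z) : auxR G X x z := Relation.ReflTransGen.trans h hn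

lemma auxR_of {V : Type*} {G : SimpleGraph V} {X : Finset V} {x y : V}
    (hx : x ∈ X) (hy : y ∈ X) (h : x = y ∨ G.Adj x y) : auxR G X x y := by
  rcases h with rfl | h
  · exact Relation.ReflTransGen.refl
  · exact Relation.ReflTransGen.single ⟨h, hx, hy⟩

lemma auxR_reach {V : Type*} {G : SimpleGraph V} {X : Finset V} {x y : V}
    (hx : x ∈ X) (h : auxR G X x y) :
    ∃ hy : y ∈ X, (G.induce (X : Set V)).Reachable ⟨x, hx⟩ ⟨y, hy⟩ := by
  induction h with
  | refl => exact ⟨hx, SimpleGraph.Reachable.refl _⟩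
  | tail _ hbc ih =>
    obtain ⟨hb, hr⟩ := ih
    refine ⟨hbc.2.2, hr.trans (SimpleGraph.Adj.reachable ?_)⟩
    exact hbc.1

/-- `S` is a set of seeds for `X`. -/
def auxSeeds {V : Type*} (G : SimpleGraph V) (X S : Finset V) : Prop :=
  S ⊆ X ∧ ∀ x ∈ X, ∃ s ∈ S, auxR G X s x

def auxDom {V : Type*} (G : SimpleGraph V) (X : Finset V) : Prop :=
  ∀ v, ∃ u ∈ X, u = v ∨ G.Adj u v

/-- two vertices merge two components -/
lemma aux_two {V : Type*} [DecidableEq V] (G : SimpleGraph V)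
    (hconn : G.Connected) (c : ℕ) : ∀ X S : Finset V, auxDom G X → auxSeeds G X S →
      S.card = c + 1 → ∃ Y s, auxDom G Y ∧ auxSeeds G Y {s} ∧ Y.card ≤ X.card + 2 * c := by
  induction c with
  | zero =>
    intro X S hX hS hc
    obtain ⟨s, rfl⟩ := Finset.card_eq_one.mp hc
    exact ⟨X, s, hX, hS, by simp⟩
  | succ c ih =>
    intro X S hX hS hc
    obtain ⟨s0, hs0⟩ : S.Nonempty := Finset.card_pos.mp (by omega)
    by_cases hall : ∀ x ∈ X, auxR G X s0 x
    · exact ⟨X, s0, hX, ⟨by simpa using hS.1 hs0, by simpa using hall⟩, by omega⟩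
    push Not at hall
    obtain ⟨b0, hb0, hb0r⟩ := hall
    -- find u, v
    obtain ⟨aa, u, v, b, haa, har, hau, huv, hvb, hb, hbr⟩ : ∃ aa u v b, aa ∈ X ∧ auxR G X s0 aa ∧
        (aa = u ∨ G.Adj aa u) ∧ (u = v ∨ G.Adj u v) ∧ (v = b ∨ G.Adj v b) ∧ b ∈ X ∧
          ¬ auxR G X s0 b := by
      let U : V → Prop := fun u => ∃ aa ∈ X, auxR G X s0 aa ∧ (aa = u ∨ G.Adj aa u)
      by_cases hU : U b0
      · obtain ⟨aa, h1, h2, h3⟩ := hU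
        exact ⟨aa, b0, b0, b0, h1, h2, h3, Or.inl rfl, Or.inl rfl, hb0, hb0r⟩
      have hs : U s0 := ⟨s0, hS.1 hs0, Relation.ReflTransGen.refl, Or.inl rfl⟩
      obtain ⟨p⟩ := hconn.preconnected s0 b0
      obtain ⟨d, hd, hd1, hd2⟩ := p.exists_boundary_dart {u | U u} hs hU
      obtain ⟨aa, h1, h2, h3⟩ := hd1
      obtain ⟨b, hb, hbv⟩ := hX d.snd
      refine ⟨aa, d.fst, d.snd, b, h1, h2, h3, Or.inr d.adj, ?_, hb, ?_⟩
      · rcases hbv with h | h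
        · exact Or.inl h.symm
        · exact Or.inr h.symm
      · intro hr
        exact hd2 ⟨b, hb, hr, hbv⟩
    obtain ⟨s1, hs1, hs1b⟩ := hS.2 b hb
    have hne : s0 ≠ s1 := by
      rintro rfl; exact hbr hs1b
    set Xn := insert u (insert v X) with hXn
    have hsub : X ⊆ Xn := by intro x hx; simp [hXn, hx]
    have hun : u ∈ Xn := by simp [hXn]
    have hvn : v ∈ Xn := by simp [hXn]
    have h0u : auxR G Xn s0 u := auxR_trans (auxR_mono hsub har) (auxR_of (hsub haa) hun hau)
    have h0v : auxR G Xn s0 v := auxR_trans h0u (auxR_of hun hvn huv)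
    have h0b : auxR G Xn s0 b := auxR_trans h0v (auxR_of hvn (hsub hb) hvb)
    have h01 : auxR G Xn s0 s1 := auxR_trans h0b (auxR_symm (auxR_mono hsub hs1b))
    have h0e : s0 ∈ S.erase s1 := Finset.mem_erase.mpr ⟨hne, hs0⟩
    suffices hsuf : auxDom G Xn ∧ (S.erase s1 ⊆ Xn ∧ ∀ x ∈ Xn, ∃ s ∈ S.erase s1, auxR G Xn s x) ∧
        (S.erase s1).card = c + 1 by
      obtain ⟨Y, s, hY1, hY2, hY3⟩ := ih Xn (S.erase s1) hsuf.1 hsuf.2.1 hsuf.2.2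
      refine ⟨Y, s, hY1, hY2, ?_⟩
      have h1 := Finset.card_insert_le u (insert v X)
      have h2 := Finset.card_insert_le v X
      rw [← hXn] at h1
      omega
    refine ⟨?_, ⟨?_, ?_⟩, ?_⟩
    · intro w
      obtain ⟨x, hx, h⟩ := hX w
      exact ⟨x, hsub hx, h⟩
    · exact (Finset.erase_subset _ _).trans (hS.1.trans hsub)
    · intro x hx
      rw [hXn, Finset.mem_insert, Finset.mem_insert] at hx
      rcases hx with rfl | rfl | hx
      · exact ⟨s0, h0e, h0u⟩
      · exact ⟨s0, h0e, h0v⟩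
      · obtain ⟨s, hs, hr⟩ := hS.2 x hx
        by_cases hss : s = s1
        · subst hss
          exact ⟨s0, h0e, auxR_trans h01 (auxR_mono hsub hr)⟩
        · exact ⟨s, Finset.mem_erase.mpr ⟨hss, hs⟩, auxR_mono hsub hr⟩
    · rw [Finset.card_erase_of_mem hs1, hc]; omega

lemma aux_conn {V : Type*} [Fintype V] [DecidableEq V] (G : SimpleGraph V) [DecidableRel G.Adj] (k : ℕ)
    [Nonempty V] (hconn : G.Connected) (hdeg : ∀ v, k ≤ G.degree v) (a : ℝ)
    (ha : a = (Fintype.card V : ℝ) / (k + 1))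
    (c : ℕ) : ∀ X S : Finset V, auxDom G X → auxSeeds G X S → S.card = c → 1 ≤ c →
      ∃ Y s, auxDom G Y ∧ auxSeeds G Y {s} ∧
      ∀ j : ℕ, 1 ≤ j → (Y.card : ℝ) + 2 ≤ X.card + (c / j + a * (1 + harmonic j - 1 / j)) := by
  have hk : (0:ℝ) < (k:ℝ) + 1 := by positivity
  have ha0 : 0 < a := by
    rw [ha]; have : (0:ℝ) < Fintype.card V := by exact_mod_cast Fintype.card_pos
    positivity
  induction c using Nat.strong_induction_on with
  | _ c ih =>
  intro X S hX hS hc hc1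
  by_cases hca : (c:ℝ) ≤ a
  · obtain ⟨Y, s, h1, h2, h3⟩ := aux_two G hconn (c - 1) X S hX hS (by omega)
    refine ⟨Y, s, h1, h2, fun j hj => ?_⟩
    have h4 : (Y.card : ℝ) + 2 ≤ X.card + 2 * c := by
      have : Y.card + 2 ≤ X.card + 2 * c := by omega
      exact_mod_cast this
    have hH := aux_harm_one j hj
    have hj1 : (1:ℝ) / j ≤ 1 := by
      rw [div_le_one (by exact_mod_cast hj)]; exact_mod_cast hj
    have h5 : (c:ℝ) * (2 - 1 / j) ≤ a * (2 - 1 / j) :=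
      mul_le_mul_of_nonneg_right hca (by linarith)
    have h6 : a * (2 - 1 / j) ≤ a * (1 + harmonic j - 1 / j) :=
      mul_le_mul_of_nonneg_left (by linarith) ha0.le
    have e : (c:ℝ) / j = c * (1 / j) := by ring
    rw [e]
    linarith
  push Not at hca
  obtain ⟨v, hv⟩ := aux_pick G k hdeg S
  set T := S.filter (fun s => s = v ∨ G.Adj v s) with hT
  have hcT : (c:ℝ) ≤ a * T.card := by
    rw [ha, div_mul_eq_mul_div, le_div_iff₀ hk]
    rw [hc] at hv
    exact_mod_cast hv
  have hT2 : 2 ≤ T.card := by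
    by_contra hlt
    have h1 : (T.card : ℝ) ≤ 1 := by exact_mod_cast (by omega : T.card ≤ 1)
    nlinarith
  obtain ⟨i, hi⟩ : ∃ i, T.card = i + 1 := ⟨T.card - 1, by omega⟩
  have hi1 : 1 ≤ i := by omega
  have hTS : T ⊆ S := Finset.filter_subset _ _
  have hTc : T.card ≤ c := hc ▸ Finset.card_le_card hTS
  set Xn := insert v X with hXn
  set Sn := insert v (S \ T) with hSn
  have hsub : X ⊆ Xn := Finset.subset_insert _ _
  have hvX : v ∈ Xn := Finset.mem_insert_self _ _
  have hcSn : Sn.card ≤ c - i := by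
    have := Finset.card_insert_le v (S \ T)
    rw [Finset.card_sdiff_of_subset hTS, hc, ← hSn] at this
    omega
  have hpos : 1 ≤ Sn.card := Finset.card_pos.mpr ⟨v, Finset.mem_insert_self _ _⟩
  suffices hsuf : auxDom G Xn ∧ (Sn ⊆ Xn ∧ ∀ x ∈ Xn, ∃ s ∈ Sn, auxR G Xn s x) by
    obtain ⟨Y, s, hY1, hY2, hY3⟩ := ih Sn.card (by omega) Xn Sn hsuf.1 hsuf.2 rfl hpos
    refine ⟨Y, s, hY1, hY2, fun j hj => ?_⟩
    have hXc : (Xn.card : ℝ) ≤ X.card + 1 := by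
      exact_mod_cast Finset.card_insert_le v X
    have hSnr : (Sn.card : ℝ) ≤ c - i := by
      have : Sn.card + i ≤ c := by omega
      have : (Sn.card : ℝ) + i ≤ c := by exact_mod_cast this
      linarith
    have hjp : (0:ℝ) < j := by exact_mod_cast hj
    have hip : (0:ℝ) < i := by exact_mod_cast hi1
    rcases le_total j i with hji | hji
    · have h := hY3 j hj
      have h2 : (Sn.card : ℝ) / j ≤ (c - i) / j := div_le_div_of_nonneg_right hSnr hjp.le
      rw [sub_div] at h2
      have : 1 ≤ (i : ℝ) / j := by
        rw [le_div_iff₀ hjp]; simpa using (by exact_mod_cast hji : (j:ℝ) ≤ i)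
      linarith
    · have h := hY3 i hi1
      have h2 : (Sn.card : ℝ) / i ≤ (c - i) / i := div_le_div_of_nonneg_right hSnr hip.le
      rw [sub_div, div_self hip.ne'] at h2
      have hh := aux_harm_div _ _ hi1 hji
      have h5 := mul_le_mul_of_nonneg_left hh ha0.le
      rw [hi] at hcT
      push_cast at hcT
      have h6 : (c:ℝ) * (1 / i - 1 / j) ≤ (a * (i + 1)) * (1 / i - 1 / j) := by
        apply mul_le_mul_of_nonneg_right hcT
        rw [sub_nonneg]
        exact one_div_le_one_div_of_le hip (by exact_mod_cast hji)
      have e1 : (a * (i + 1)) * (1 / i - 1 / j) = a * (1 - (i:ℝ) / j) + a * (1 / i) - a * (1 / j) := by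
        field_simp
        ring
      have e2 : (c:ℝ) * (1 / i - 1 / j) = c / i - c / j := by ring
      rw [e1, e2] at h6
      linarith
  refine ⟨?_, ⟨?_, ?_⟩⟩
  · intro w
    obtain ⟨x, hx, h⟩ := hX w
    exact ⟨x, hsub hx, h⟩
  · intro x hx
    rw [hSn, Finset.mem_insert, Finset.mem_sdiff] at hx
    rcases hx with rfl | hx
    · exact hvX
    · exact hsub (hS.1 hx.1)
  · intro x hx
    rw [hXn, Finset.mem_insert] at hx
    rcases hx with rfl | hx
    · exact ⟨x, Finset.mem_insert_self _ _, Relation.ReflTransGen.refl⟩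
    · obtain ⟨s, hs, hr⟩ := hS.2 x hx
      by_cases hsT : s ∈ T
      · refine ⟨v, Finset.mem_insert_self _ _, auxR_trans (auxR_of hvX (hsub (hS.1 hs)) ?_) (auxR_mono hsub hr)⟩
        rcases (Finset.mem_filter.mp hsT).2 with h | h
        · exact Or.inl h.symm
        · exact Or.inr h
      · exact ⟨s, by simp [hSn, hs, hsT], auxR_mono hsub hr⟩

/-- **Connected domination versus domination.** For a connected graph `G` with `n` vertices and
minimum degree at least `k`, `γ_c(G) < γ(G) + (n/(k+1))·(ln⌈ln(k+1)⌉ + 3)`. -/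
theorem connectedDomination_lt_domination_add {V : Type*} [Fintype V]
    (G : SimpleGraph V) [DecidableRel G.Adj] (n k : ℕ)
    (hn : Fintype.card V = n) (hconn : G.Connected) (hdeg : ∀ v, k ≤ G.degree v) :
    (connectedDominationNumber G : ℝ) <
      (dominationNumber G : ℝ) +
        (n : ℝ) / ((k : ℝ) + 1) * (Real.log (⌈Real.log ((k : ℝ) + 1)⌉₊ : ℝ) + 3) := by
  classical
  have : Nonempty V := hconn.nonempty
  obtain ⟨a, ha⟩ : ∃ a : ℝ, a = (Fintype.card V : ℝ) / (k + 1) := ⟨_, rfl⟩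
  have hk : (0:ℝ) < (k:ℝ) + 1 := by positivity
  have hnpos : (0:ℝ) < Fintype.card V := by exact_mod_cast Fintype.card_pos
  have ha0 : 0 < a := by rw [ha]; positivity
  -- a minimum dominating set
  have hne : {c | ∃ X : Set V, IsDominatingSet G X ∧ X.ncard = c}.Nonempty :=
    ⟨_, Set.univ, fun v hv => absurd (Set.mem_univ v) hv, rfl⟩
  obtain ⟨X0, hX0, hX0c⟩ := Nat.sInf_mem hne
  change X0.ncard = dominationNumber G at hX0c
  have hXd : auxDom G X0.toFinset := by
    intro v
    by_cases hv : v ∈ X0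
    · exact ⟨v, by simpa using hv, Or.inl rfl⟩
    · obtain ⟨u, hu, h⟩ := hX0 v hv
      exact ⟨u, by simpa using hu, Or.inr h⟩
  have hXcard : X0.toFinset.card = dominationNumber G := by
    rw [← hX0c, Set.ncard_eq_toFinset_card']
  have hpos : 1 ≤ X0.toFinset.card := by
    obtain ⟨u, hu, _⟩ := hXd (Classical.arbitrary V)
    exact Finset.card_pos.mpr ⟨u, hu⟩
  obtain ⟨Y, s, hY1, hY2, hY3⟩ := aux_conn G k hconn hdeg a ha _ X0.toFinset X0.toFinset hXd
    ⟨subset_rfl, fun x hx => ⟨x, hx, Relation.ReflTransGen.refl⟩⟩ rfl hpos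
  have hle : connectedDominationNumber G ≤ Y.card := by
    apply Nat.sInf_le
    refine ⟨(Y : Set V), ?_, ?_, Set.ncard_coe_finset Y⟩
    · intro v hv
      obtain ⟨u, hu, h⟩ := hY1 v
      rcases h with rfl | h
      · exact absurd hu hv
      · exact ⟨u, hu, h⟩
    · have hs : s ∈ Y := hY2.1 (by simp)
      rw [SimpleGraph.connected_iff_exists_forall_reachable]
      refine ⟨⟨s, hs⟩, ?_⟩
      rintro ⟨y, hy⟩
      obtain ⟨sn, hsn, hr⟩ := hY2.2 y hy
      rw [Finset.mem_singleton] at hsn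
      subst hsn
      exact (auxR_reach hs hr).2
  have hleR : (connectedDominationNumber G : ℝ) ≤ Y.card := by exact_mod_cast hle
  -- bound on the domination number
  obtain ⟨D, hD1, hD2⟩ := aux_dom G k hdeg a ha _ (Finset.univ : Finset V) rfl
  have hγD : dominationNumber G ≤ D.card := by
    apply Nat.sInf_le
    refine ⟨(D : Set V), ?_, Set.ncard_coe_finset D⟩
    intro v hv
    obtain ⟨u, hu, h⟩ := hD1 v (Finset.mem_univ v)
    rcases h with rfl | h
    · exact absurd hu hv
    · exact ⟨u, hu, h⟩
  have hγDR : (dominationNumber G : ℝ) ≤ D.card := by exact_mod_cast hγD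
  have hD3 := hD2 (k + 1) (by omega)
  have hlog := harmonic_le_one_add_log (k + 1)
  rw [Finset.card_univ] at hD3
  push_cast at hD3 hlog
  rw [← ha] at hD3
  have hγ : (dominationNumber G : ℝ) ≤ a * (1 + Real.log (k + 1)) := by
    have := mul_le_mul_of_nonneg_left hlog ha0.le
    linarith
  rw [← hn, ← ha]
  rw [hXcard] at hY3
  rcases Nat.eq_zero_or_pos k with h0 | hkpos
  · subst h0
    have h := hY3 1 le_rfl
    simp at h hγ ⊢
    linarith
  · set L := ⌈Real.log ((k : ℝ) + 1)⌉₊ with hL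
    have hlp : 0 < Real.log ((k : ℝ) + 1) := Real.log_pos (by
      have : (0:ℝ) < k := by exact_mod_cast hkpos
      linarith)
    have hL1 : 1 ≤ L := Nat.ceil_pos.mpr hlp
    have hLp : (0:ℝ) < L := by exact_mod_cast hL1
    have hLl : Real.log ((k : ℝ) + 1) ≤ L := Nat.le_ceil _
    have h := hY3 L hL1
    have hγ2 : (dominationNumber G : ℝ) ≤ a * (1 + L) :=
      hγ.trans (mul_le_mul_of_nonneg_left (by linarith) ha0.le)
    have h3 : (dominationNumber G : ℝ) / L ≤ a * (1 + L) / L :=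
      div_le_div_of_nonneg_right hγ2 hLp.le
    have e : a * (1 + L) / L = a * (1 / L) + a := by field_simp
    rw [e] at h3
    have h4 := mul_le_mul_of_nonneg_left (harmonic_le_one_add_log L) ha0.le
    linarith
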